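/- Let L be a regular tree language and A_can its canonical bottom-up automaton. For any two states q, q′ of A_can, if t_{q′}⁻¹L ⊊ t_q⁻¹L then the set of contexts accepted by q′ in A_can is contained in the set of contexts accepted by q: C_{q′} ⊆ C_q. -/

import Mathlib

/-- Terms over a ranked alphabet `F` with arity function `arity`. -/
inductive Term (F : Type) (arity : F → ℕ) : Type where
  | node (f : F) (children : Fin (arity f) → Term F arity) : Term F arity

/-- Contexts: terms with exactly one occurrence of the hole `◇`. -/
inductive Ctx (F : Type) (arity : F → ℕ) : Type where
  | hole : Ctx F arity
  | node (f : F) (i : Fin (arity f)) (c : Ctx F arity)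
      (sib : (j : Fin (arity f)) → j ≠ i → Term F arity) : Ctx F arity

/-- `c.fill t` replaces the hole of `c` by the term `t`. -/
def Ctx.fill {F : Type} {arity : F → ℕ} : Ctx F arity → Term F arity → Term F arity
  | .hole, t => t
  | .node f i c sib, t => .node f (fun j => if h : j = i then c.fill t else sib j h)

/-- Bottom-up residual of the tree language `L` w.r.t. the term `t`:
the set of contexts `c` with `c[t] ∈ L`. -/
def bres {F : Type} {arity : F → ℕ} (L : Set (Term F arity)) (t : Term F arity) :
    Set (Ctx F arity) := {c | c.fill t ∈ L}

/-- Bottom-up finite tree automaton with state type `Q`: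
final states and a set of rules `f(q₁,…,qₙ) → q`. -/
structure BUTA (F : Type) (arity : F → ℕ) (Q : Type) where
  final : Set Q
  rules : (f : F) → (Fin (arity f) → Q) → Q → Prop

/-- Reachability `t →*_A q`. -/
inductive BUTA.Reach {F Q : Type} {arity : F → ℕ} (A : BUTA F arity Q) :
    Term F arity → Q → Prop
  | node {f : F} {ch : Fin (arity f) → Term F arity} {qs : Fin (arity f) → Q} {q : Q} :
      A.rules f qs q → (∀ i, A.Reach (ch i) (qs i)) → A.Reach (.node f ch) q

/-- Language recognized by a bottom-up tree automaton. -/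
def BUTA.lang {F Q : Type} {arity : F → ℕ} (A : BUTA F arity Q) : Set (Term F arity) :=
  {t | ∃ q ∈ A.final, A.Reach t q}

/-- `A.CReach q0 c q` : putting state `q0` in the hole of `c`, the automaton can reach `q`
at the root (extending `→*_A` to terms over `F ∪ Q` by `q →*_A q`). -/
inductive BUTA.CReach {F Q : Type} {arity : F → ℕ} (A : BUTA F arity Q) (q0 : Q) :
    Ctx F arity → Q → Prop
  | hole : A.CReach q0 .hole q0
  | node {f : F} {i : Fin (arity f)} {c : Ctx F arity}
      {sib : (j : Fin (arity f)) → j ≠ i → Term F arity}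
      {qs : Fin (arity f) → Q} {q : Q} :
      A.rules f qs q → A.CReach q0 c (qs i) →
      (∀ j (h : j ≠ i), A.Reach (sib j h) (qs j)) →
      A.CReach q0 (.node f i c sib) q

/-- State language `C_q`: the set of contexts accepted by the state `q`. -/
def BUTA.stateLang {F Q : Type} {arity : F → ℕ} (A : BUTA F arity Q) (q : Q) :
    Set (Ctx F arity) := {c | ∃ qf ∈ A.final, A.CReach q c qf}

/-- A bottom-up automaton is deterministic iff no two rules share a left-hand side. -/
def BUTA.Deterministic {F Q : Type} {arity : F → ℕ} (A : BUTA F arity Q) : Prop :=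
  ∀ (f : F) (qs : Fin (arity f) → Q) (q q' : Q), A.rules f qs q → A.rules f qs q' → q = q'

/-- Bottom-up residual finite tree automaton: each state language is a residual of `L(A)`. -/
def IsRFTA {F Q : Type} {arity : F → ℕ} (A : BUTA F arity Q) : Prop :=
  ∀ q : Q, ∃ t : Term F arity, A.stateLang q = bres A.lang t

/-- A bottom-up residual is composite iff it is the union of the bottom-up residuals
of `L` that it strictly contains. -/
def IsCompositeRes {F : Type} {arity : F → ℕ} (L : Set (Term F arity))
    (t : Term F arity) : Prop :=
  bres L t = ⋃ t' ∈ {t' : Term F arity | bres L t' ⊂ bres L t}, bres L t'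

/-- A bottom-up residual is prime iff it is not composite. -/
def IsPrimeRes {F : Type} {arity : F → ℕ} (L : Set (Term F arity))
    (t : Term F arity) : Prop := ¬ IsCompositeRes L t

/-- The canonical bottom-up automaton of `L`, given a family `tq` of representative terms
(one per prime bottom-up residual of `L`): final states are the `q` with `◇ ∈ t_q⁻¹L`,
and the rules are the `f(q₁,…,qₙ) → q` with `t_q⁻¹L ⊆ f(t_{q₁},…,t_{qₙ})⁻¹L`. -/
def canonBU {F : Type} {arity : F → ℕ} (L : Set (Term F arity)) {Q : Type}
    (tq : Q → Term F arity) : BUTA F arity Q where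
  final := {q | Ctx.hole ∈ bres L (tq q)}
  rules f qs q := bres L (tq q) ⊆ bres L (.node f (fun i => tq (qs i)))

/-- Composition of contexts: `c.comp d` replaces the hole of `c` by `d`. -/
def Ctx.comp {F : Type} {arity : F → ℕ} : Ctx F arity → Ctx F arity → Ctx F arity
  | .hole, d => d
  | .node f i c sib, d => .node f i (c.comp d) sib

theorem Ctx.fill_comp {F : Type} {arity : F → ℕ} (c d : Ctx F arity) (t : Term F arity) :
    (c.comp d).fill t = c.fill (d.fill t) := by
  induction c with
  | hole => rfl
  | node f i c sib ih => simp only [Ctx.comp, Ctx.fill, ih]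

/-- Inclusion of residuals is preserved by plugging the terms into a context. -/
theorem bres_fill_mono {F : Type} {arity : F → ℕ} {L : Set (Term F arity)}
    {t t' : Term F arity} (h : bres L t ⊆ bres L t') (d : Ctx F arity) :
    bres L (d.fill t) ⊆ bres L (d.fill t') := by
  intro c hc
  have := @h (c.comp d)
  simp only [bres, Set.mem_ofPred_eq, Ctx.fill_comp] at this hc ⊢
  exact this hc

/-- Replacing a state on the left-hand side of a canonical rule by one with a larger residual
yields a canonical rule. -/
theorem canonBU_rules_update {F Q : Type} {arity : F → ℕ} {L : Set (Term F arity)}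
    {tq : Q → Term F arity} {f : F} {qs : Fin (arity f) → Q} {p q : Q} {i : Fin (arity f)}
    (hr : (canonBU L tq).rules f qs p) (h : bres L (tq (qs i)) ⊆ bres L (tq q)) :
    (canonBU L tq).rules f (Function.update qs i q) p := by
  have key := bres_fill_mono h (.node f i .hole fun j _ => tq (qs j))
  have e₁ : (Ctx.node f i .hole fun j _ => tq (qs j)).fill (tq (qs i)) =
      .node f fun j => tq (qs j) := by
    simp only [Ctx.fill]
    congr 1
    funext j
    split_ifs with hj
    · rw [hj]
    · rfl
  have e₂ : (Ctx.node f i .hole fun j _ => tq (qs j)).fill (tq q) =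
      .node f fun j => tq (Function.update qs i q j) := by
    simp only [Ctx.fill]
    congr 1
    funext j
    split_ifs with hj
    · subst hj
      rw [Function.update_self]
    · rw [Function.update_of_ne hj]
  rw [e₁, e₂] at key
  exact Set.Subset.trans hr key

/-- A run of the canonical automaton on a context either is the trivial one or can be started
from any state with a larger residual. -/
theorem canonBU_CReach_mono {F Q : Type} {arity : F → ℕ} {L : Set (Term F arity)}
    {tq : Q → Term F arity} {q q' : Q} (h : bres L (tq q') ⊆ bres L (tq q))
    {c : Ctx F arity} {p : Q} (hc : (canonBU L tq).CReach q' c p) :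
    c = .hole ∧ p = q' ∨ (canonBU L tq).CReach q c p := by
  induction hc with
  | hole => exact .inl ⟨rfl, rfl⟩
  | @node f i c sib qs p hr _ hs ih =>
    right
    rcases ih with ⟨rfl, hq⟩ | ih
    · refine .node (qs := Function.update qs i q) (canonBU_rules_update hr (hq ▸ h)) ?_ ?_
      · rw [Function.update_self]
        exact .hole
      · intro j hj
        rw [Function.update_of_ne hj]
        exact hs j hj
    · exact .node hr ih hs

/-- In the canonical bottom-up automaton of a regular tree language `L`:
if `t_{q′}⁻¹L ⊊ t_q⁻¹L` then `C_{q′} ⊆ C_q`. -/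
theorem canonBU_stateLang_mono {F Q : Type} [Fintype F] [Fintype Q] {arity : F → ℕ}
    (_hconst : ∃ a : F, arity a = 0) (L : Set (Term F arity))
    (hreg : ∃ (Q' : Type) (_ : Fintype Q') (A : BUTA F arity Q'), A.lang = L)
    (tq : Q → Term F arity)
    (hprime : ∀ q, IsPrimeRes L (tq q))
    (hinj : ∀ q q', bres L (tq q) = bres L (tq q') → q = q')
    (hsurj : ∀ t : Term F arity, IsPrimeRes L t → ∃ q, bres L (tq q) = bres L t) :
    ∀ q q' : Q, bres L (tq q') ⊂ bres L (tq q) →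
      (canonBU L tq).stateLang q' ⊆ (canonBU L tq).stateLang q := by
  rintro q q' h c ⟨p, hp, hc⟩
  rcases canonBU_CReach_mono h.subset hc with ⟨rfl, rfl⟩ | hc
  · exact ⟨q, h.subset hp, .hole⟩
  · exact ⟨p, hp, hc⟩
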